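/- Let P be a finite planar point set in general position and let ℒ be the lattice of closed sets of the realizable convex geometry on P. If the order dimension of ℒ equals k, then |P| ≤ 2^{k−1}. Equivalently, if |P| > 2^{n−2} then dim(ℒ) ≥ n. -/

import Mathlib

/-- `A` is a closed set of the realizable convex geometry on the finite planar point set
`P`, whose closure operator is `L(A) = conv(A) ∩ P`: that is, `A ⊆ P` and
`conv(A) ∩ P ⊆ A`. -/
def RClosed (P A : Finset (ℝ × ℝ)) : Prop :=
  A ⊆ P ∧ ∀ x ∈ P, x ∈ convexHull ℝ (A : Set (ℝ × ℝ)) → x ∈ A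

/-- `A` is a copoint of the realizable convex geometry on `P`: a closed set such that
there is exactly one closed set `B` with `|B \ A| = 1`. -/
def RCopoint (P A : Finset (ℝ × ℝ)) : Prop :=
  RClosed P A ∧ ∃! B, RClosed P B ∧ (B \ A).card = 1

/-- The copoint `A` is attached to the point `p` (i.e. `p = α(A)`). -/
def RAttached (P A : Finset (ℝ × ℝ)) (p : ℝ × ℝ) : Prop :=
  RCopoint P A ∧ ∃ B, RClosed P B ∧ B \ A = {p}

/-- A cycle of copoints `(A 0, …, A (l-1))` with attachment points `a i = α(A i)`:
the copoints are pairwise distinct and `α(A i) ∈ A (i+1)` cyclically. -/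
def RCycle (P : Finset (ℝ × ℝ)) {l : ℕ} (A : Fin l → Finset (ℝ × ℝ))
    (a : Fin l → ℝ × ℝ) : Prop :=
  Function.Injective A ∧ (∀ i, RAttached P (A i) (a i)) ∧
  ∀ i : Fin l, a i ∈ A ⟨(i.1 + 1) % l, Nat.mod_lt _ i.pos⟩

/-- A minimal cycle of copoints: no nonempty proper subfamily of its copoints can be
arranged into a cycle of copoints. -/
def RMinCycle (P : Finset (ℝ × ℝ)) {l : ℕ} (A : Fin l → Finset (ℝ × ℝ))
    (a : Fin l → ℝ × ℝ) : Prop :=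
  RCycle P A a ∧ ∀ (m : ℕ) (B : Fin m → Finset (ℝ × ℝ)) (b : Fin m → ℝ × ℝ),
    0 < m → RCycle P B b → ¬ Set.range B ⊂ Set.range A

/-- A planar point set is in general position if no three of its points are collinear. -/
def GenPos (P : Finset (ℝ × ℝ)) : Prop :=
  ∀ a ∈ P, ∀ b ∈ P, ∀ c ∈ P, a ≠ b → a ≠ c → b ≠ c →
    ¬ Collinear ℝ ({a, b, c} : Set (ℝ × ℝ))

/-- Every line through two points of `S` has (finite) slope strictly smaller than the slope
of the line through `l` and `m` (pairs are ordered by first coordinate; the inequality is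
stated in cross-multiplied form, valid since `l.1 < m.1` in a composition). -/
def SlopeLT (S : Finset (ℝ × ℝ)) (l m : ℝ × ℝ) : Prop :=
  ∀ a ∈ S, ∀ b ∈ S, a.1 < b.1 → (b.2 - a.2) * (m.1 - l.1) < (m.2 - l.2) * (b.1 - a.1)

/-- `P` is a composition of `L` and `M` (where `M` is identified with its translate):
`P = L ∪ M`, every point of `M` has greater first coordinate than every point of `L`, all
lines through two points of `L` or through two points of `M` are non-vertical, and the
slope of any line from `L` to `M` exceeds the slope of any line within `L` or within `M`. -/
def CompOf (P L M : Finset (ℝ × ℝ)) : Prop :=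
  P = L ∪ M ∧
  (∀ a ∈ L, ∀ b ∈ L, a ≠ b → a.1 ≠ b.1) ∧
  (∀ a ∈ M, ∀ b ∈ M, a ≠ b → a.1 ≠ b.1) ∧
  (∀ l ∈ L, ∀ m ∈ M, l.1 < m.1) ∧
  (∀ l ∈ L, ∀ m ∈ M, SlopeLT L l m ∧ SlopeLT M l m)

/-- `P` is a composition of the point sets in the list `Ls`, via iterated binary
compositions whose leaves, read left to right, are the members of `Ls`. -/
inductive CompOfList : Finset (ℝ × ℝ) → List (Finset (ℝ × ℝ)) → Prop
  | single (L : Finset (ℝ × ℝ)) : CompOfList L [L]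
  | comp {P Q R : Finset (ℝ × ℝ)} {ls ms : List (Finset (ℝ × ℝ))} :
      CompOfList Q ls → CompOfList R ms → CompOf P Q R → CompOfList P (ls ++ ms)

/-- The lattice of closed sets of the realizable convex geometry on `P` has a realizer of
size `t`: `t` linear extensions of the inclusion order on closed sets whose intersection is
the inclusion order. -/
def RHasRealizer (P : Finset (ℝ × ℝ)) (t : ℕ) : Prop :=
  ∃ r : Fin t → ({A : Finset (ℝ × ℝ) // RClosed P A} →
      {A : Finset (ℝ × ℝ) // RClosed P A} → Prop),
    (∀ i, IsLinearOrder _ (r i)) ∧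
    (∀ i A B, A.1 ⊆ B.1 → r i A B) ∧
    (∀ A B, (∀ i, r i A B) → A.1 ⊆ B.1)

open Finset in
/-- If every `t d ⊆ I` holds a strict majority of `I`, then `a` and `b` can be merged, after possibly
deleting one further element of `I`, so that the strict majorities persist. -/
theorem exists_subset_majority_merge {α β : Type*} [DecidableEq β]
    (D : Finset α) (I : Finset β) (t : α → Finset β) (ht : ∀ d ∈ D, t d ⊆ I)
    (hmaj : ∀ d ∈ D, #I < 2 * #(t d)) {a b : β} (hab : a ≠ b) (ha : a ∈ I) (hb : b ∈ I)
    (hcover : ∀ E ⊆ D, E.Nonempty → (∀ d ∈ E, a ∈ t d ∧ b ∈ t d) →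
      ∃ d ∈ E, ∃ d' ∈ E, ∀ e ∈ E, t e ⊆ t d ∪ t d') :
    ∃ J ⊆ I, a ∈ J ∧ ∀ d ∈ D,
      #(J.erase b) < 2 * #((t d ∩ J).image fun x => if x = b then a else x) := by
  classical
  have hmerge : ∀ s : Finset β,
      #s ≤ #(s.image fun x => if x = b then a else x) + if a ∈ s ∧ b ∈ s then 1 else 0 := by
    intro s
    by_cases h : a ∈ s ∧ b ∈ s
    · have hsub : s.erase b ⊆ s.image fun x => if x = b then a else x := by
        intro x hx
        rw [mem_erase] at hx
        exact mem_image.2 ⟨x, hx.2, if_neg hx.1⟩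
      have := card_le_card hsub
      rw [card_erase_of_mem h.2] at this
      rw [if_pos h]
      omega
    · rw [if_neg h, add_zero, card_image_of_injOn]
      intro x hx y hy hxy
      simp only at hxy
      split_ifs at hxy <;> grind
  have hIb : #(I.erase b) = #I - 1 := card_erase_of_mem hb
  have hIpos : 0 < #I := card_pos.2 ⟨a, ha⟩
  let E := D.filter fun d => 2 * #(t d) = #I + 1 ∧ a ∈ t d ∧ b ∈ t d
  by_cases hE : E.Nonempty
  · obtain ⟨d, hd, d', hd', hdd⟩ := hcover E (filter_subset _ _) hE
      fun d hd => (mem_filter.1 hd).2.2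
    obtain ⟨hdD, hdc, hda, hdb⟩ := mem_filter.1 hd
    obtain ⟨hdD', hdc', hda', hdb'⟩ := mem_filter.1 hd'
    have hinter : 2 ≤ #(t d ∩ t d') := by
      rw [← card_pair hab]
      apply card_le_card
      intro x hx
      rw [mem_insert, mem_singleton] at hx
      rcases hx with rfl | rfl <;> simp [*]
    have hunion := card_union_add_card_inter (t d) (t d')
    obtain ⟨l, hlI, hl⟩ : ∃ l ∈ I, l ∉ t d ∪ t d' :=
      exists_mem_notMem_of_card_lt_card (by omega)
    have hla : a ≠ l := by rintro rfl; exact hl (mem_union_left _ hda)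
    have hlb : b ≠ l := by rintro rfl; exact hl (mem_union_left _ hdb)
    refine ⟨I.erase l, erase_subset _ _, mem_erase.2 ⟨hla, ha⟩, fun e he => ?_⟩
    have hJ : #((I.erase l).erase b) = #I - 2 := by
      rw [card_erase_of_mem (mem_erase.2 ⟨hlb, hb⟩), card_erase_of_mem hlI]; omega
    have hte : t e ∩ I.erase l = (t e).erase l := by
      ext x
      have := @ht e he x
      simp only [mem_inter, mem_erase]
      tauto
    have hm := hmerge ((t e).erase l)
    have hmaj_e := hmaj e he
    have hI3 : 3 ≤ #I := by
      have : #({a, b, l} : Finset β) ≤ #I := by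
        apply card_le_card
        intro x hx
        simp only [mem_insert, mem_singleton] at hx
        rcases hx with rfl | rfl | rfl <;> assumption
      rwa [card_eq_three.2 ⟨a, b, l, hab, hla, hlb, rfl⟩] at this
    rw [hJ, hte]
    by_cases heE : e ∈ E
    · have hle : l ∉ t e := fun h => hl (hdd e heE h)
      rw [erase_eq_of_notMem hle] at hm ⊢
      split_ifs at hm <;> omega
    · have hcard : #(t e) ≤ #((t e).erase l) + 1 :=
        Nat.sub_le_iff_le_add.1 pred_card_le_card_erase
      by_cases h : a ∈ t e ∧ b ∈ t e
      · have : 2 * #(t e) ≠ #I + 1 := fun h' => heE (mem_filter.2 ⟨he, h', h⟩)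
        have hpar : #I % 2 = 1 := by omega
        split_ifs at hm <;> omega
      · rw [if_neg (fun h' => h ⟨mem_of_mem_erase h'.1, mem_of_mem_erase h'.2⟩)] at hm
        omega
  · refine ⟨I, Subset.rfl, ha, fun e he => ?_⟩
    rw [inter_eq_left.2 (ht e he), hIb]
    have hm := hmerge (t e)
    have hmaj_e := hmaj e he
    split_ifs at hm with h
    · have : 2 * #(t e) ≠ #I + 1 := fun h' => hE ⟨e, mem_filter.2 ⟨he, h', h⟩⟩
      omega
    · omega

open Finset in
/-- If every `T d` contains a strict majority of the index type, and the sets `T d` are convex along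
`key` in each colour class and satisfy a two-set covering property, then some set of indices has
colours of which each `T d` meets a strict majority. -/
theorem exists_majority_image {α ι κ : Type*} [Fintype ι] [DecidableEq ι] [DecidableEq κ]
    (D : Finset α) (T : α → Finset ι) (col : ι → κ) (key : ι → ℝ)
    (hconv : ∀ d ∈ D, ∀ i j k, col i = col j → col j = col k → key i ≤ key j → key j ≤ key k →
      i ∈ T d → k ∈ T d → j ∈ T d)
    (hcover : ∀ b, ∀ E ⊆ D, E.Nonempty → (∀ d ∈ E, b ∈ T d) →
      ∃ d ∈ E, ∃ d' ∈ E, ∀ e ∈ E, T e ⊆ T d ∪ T d')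
    (hmaj : ∀ d ∈ D, Fintype.card ι < 2 * #(T d)) :
    ∃ A : Finset ι, ∀ d ∈ D, #(A.image col) < 2 * #((A ∩ T d).image col) := by
  let lab : Finset ι → ι → κ ⊕ ι := fun F i => if i ∈ F then Sum.inl (col i) else Sum.inr i
  have key_step : ∀ F : Finset ι, ∃ A : Finset ι, ∀ d ∈ D,
      #(A.image (lab F)) < 2 * #((A ∩ T d).image (lab F)) := by
    intro F
    induction F using Finset.induction_on_max_value key with
    | empty =>
      refine ⟨univ, fun d hd => ?_⟩
      have hlab : lab ∅ = Sum.inr := by ext i; simp [lab]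
      rw [hlab, card_image_of_injective _ Sum.inr_injective,
        card_image_of_injective _ Sum.inr_injective, univ_inter]
      exact hmaj d hd
    | insert a s has hmax ih =>
      obtain ⟨A, hA⟩ := ih
      let m : κ ⊕ ι → κ ⊕ ι := fun x => if x = Sum.inr a then Sum.inl (col a) else x
      have hlab : lab (insert a s) = m ∘ lab s := by
        funext i
        by_cases hi : i = a
        · subst hi; simp [lab, m, has]
        · by_cases his : i ∈ s <;> simp [lab, m, hi, his]
      by_cases hI : Sum.inl (col a) ∈ A.image (lab s) ∧ Sum.inr a ∈ A.image (lab s)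
      · obtain ⟨J, hJI, haJ, hJ⟩ := exists_subset_majority_merge D (A.image (lab s))
          (fun d => (A ∩ T d).image (lab s))
          (fun d _ => image_subset_image inter_subset_left) hA (by simp) hI.1 hI.2 (by
            intro E hED hEne hE
            have hinl : ∀ d ∈ E, ∃ i ∈ s, col i = col a ∧ i ∈ T d := by
              intro d hd
              obtain ⟨i, hi, hia⟩ := mem_image.1 (hE d hd).1
              by_cases his : i ∈ s
              · exact ⟨i, his, by simpa [lab, his] using hia, (mem_inter.1 hi).2⟩
              · simp [lab, his] at hia
            have hinr : ∀ d ∈ E, a ∈ T d := by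
              intro d hd
              obtain ⟨i, hi, hia⟩ := mem_image.1 (hE d hd).2
              by_cases his : i ∈ s
              · simp [lab, his] at hia
              · have : i = a := by simpa [lab, his] using hia
                exact this ▸ (mem_inter.1 hi).2
            obtain ⟨d₀, hd₀⟩ := hEne
            obtain ⟨i₀, hi₀, hci₀, -⟩ := hinl d₀ hd₀
            obtain ⟨b, hb, hbmax⟩ := exists_max_image (s.filter fun i => col i = col a) key
              ⟨i₀, mem_filter.2 ⟨hi₀, hci₀⟩⟩
            rw [mem_filter] at hb
            obtain ⟨d, hd, d', hd', hdd⟩ := hcover b E hED ⟨d₀, hd₀⟩ (by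
              intro d hd
              obtain ⟨i, his, hic, hiT⟩ := hinl d hd
              exact hconv d (hED hd) i b a (hic.trans hb.2.symm) hb.2
                (hbmax i (mem_filter.2 ⟨his, hic⟩)) (hmax b hb.1) hiT (hinr d hd))
            refine ⟨d, hd, d', hd', fun e he => ?_⟩
            rw [← image_union, ← inter_union_distrib_left]
            exact image_subset_image (inter_subset_inter_left (hdd e he)))
        refine ⟨A.filter fun i => lab s i ∈ J, fun d hd => ?_⟩
        have h₁ : (A.filter fun i => lab s i ∈ J).image (lab (insert a s)) ⊆
            J.erase (Sum.inr a) := by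
          intro x hx
          obtain ⟨i, hi, rfl⟩ := mem_image.1 hx
          rw [hlab]
          by_cases h : lab s i = Sum.inr a
          · simp [m, h, haJ]
          · simpa [m, h] using (mem_filter.1 hi).2
        have h₂ : ((A ∩ T d).image (lab s) ∩ J).image m ⊆
            ((A.filter fun i => lab s i ∈ J) ∩ T d).image (lab (insert a s)) := by
          intro x hx
          obtain ⟨y, hy, rfl⟩ := mem_image.1 hx
          obtain ⟨hy₁, hyJ⟩ := mem_inter.1 hy
          obtain ⟨i, hi, rfl⟩ := mem_image.1 hy₁
          rw [hlab]
          refine mem_image.2 ⟨i, ?_, rfl⟩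
          simp only [mem_inter, mem_filter] at hi ⊢
          exact ⟨⟨hi.1, hyJ⟩, hi.2⟩
        have h₃ := card_le_card h₁
        have h₄ := card_le_card h₂
        have h₅ := hJ d hd
        change _ < 2 * #(((A ∩ T d).image (lab s) ∩ J).image m) at h₅
        omega
      · refine ⟨A, fun d hd => ?_⟩
        have hinj : Set.InjOn m (A.image (lab s) : Set (κ ⊕ ι)) := by
          intro x hx y hy hxy
          rw [mem_coe] at hx hy
          simp only [m] at hxy
          split_ifs at hxy <;> grind
        have hsub : (A ∩ T d).image (lab s) ⊆ A.image (lab s) :=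
          image_subset_image inter_subset_left
        have h₁ : #((A.image (lab s)).image m) = #(A.image (lab s)) := card_image_of_injOn hinj
        have h₂ : #(((A ∩ T d).image (lab s)).image m) = #((A ∩ T d).image (lab s)) :=
          card_image_of_injOn (hinj.mono (coe_subset.2 hsub))
        rw [hlab, ← image_image, ← image_image, h₁, h₂]
        exact hA d hd
  obtain ⟨A, hA⟩ := key_step univ
  refine ⟨A, fun d hd => ?_⟩
  have hlab : lab univ = Sum.inl ∘ col := by ext i; simp [lab]
  have h := hA d hd
  rwa [hlab, ← image_image, ← image_image, card_image_of_injective _ Sum.inl_injective,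
    card_image_of_injective _ Sum.inl_injective] at h

/-- The standard scalar product on the plane. -/
def planeDot (v d : ℝ × ℝ) : ℝ := v.1 * d.1 + v.2 * d.2

/-- The standard determinant form on the plane. -/
def planeCross (v d : ℝ × ℝ) : ℝ := v.1 * d.2 - v.2 * d.1

/-- The coordinates of `v` and `d` along `w` and its rotation determine their scalar product. -/
theorem planeDot_self_mul (w v d : ℝ × ℝ) :
    planeDot w w * planeDot v d =
      planeDot w v * planeDot w d + planeCross w v * planeCross w d := by
  simp only [planeDot, planeCross]; ring

theorem planeDot_self_pos {w : ℝ × ℝ} (hw : w ≠ 0) : 0 < planeDot w w := by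
  have h : w.1 ≠ 0 ∨ w.2 ≠ 0 := by
    by_contra! h
    exact hw (Prod.ext h.1 h.2)
  simp only [planeDot]
  rcases h with h | h
  · nlinarith [mul_self_pos.2 h, mul_self_nonneg w.2]
  · nlinarith [mul_self_pos.2 h, mul_self_nonneg w.1]

/-- An affine function positive at two reals is positive between them. -/
theorem affine_pos_of_between {A B x y z : ℝ} (hxy : x ≤ y) (hyz : y ≤ z)
    (hx : 0 < A + B * x) (hz : 0 < A + B * z) : 0 < A + B * y := by
  rcases le_total 0 B with hB | hB
  · nlinarith [mul_le_mul_of_nonneg_left hxy hB]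
  · nlinarith [mul_le_mul_of_nonpos_left hyz hB]

/-- Three points of a set in general position span independent directions. -/
theorem GenPos.planeCross_ne_zero {P : Finset (ℝ × ℝ)} (hgen : GenPos P) {p q r : ℝ × ℝ}
    (hp : p ∈ P) (hq : q ∈ P) (hr : r ∈ P) (hpq : p ≠ q) (hpr : p ≠ r) (hqr : q ≠ r) :
    planeCross (q - p) (r - p) ≠ 0 := by
  intro h
  refine hgen p hp q hq r hr hpq hpr hqr ?_
  rw [collinear_iff_of_mem (p₀ := p) (by simp)]
  have hw : q - p ≠ 0 := sub_ne_zero.2 hpq.symm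
  have hpos := planeDot_self_pos hw
  refine ⟨q - p, ?_⟩
  intro x hx
  simp only [Set.mem_insert_iff, Set.mem_singleton_iff] at hx
  rcases hx with rfl | rfl | rfl
  · exact ⟨0, by simp⟩
  · exact ⟨1, by simp⟩
  · refine ⟨planeDot (q - p) (x - p) / planeDot (q - p) (q - p), ?_⟩
    simp only [planeCross, Prod.fst_sub, Prod.snd_sub] at h
    ext
    · simp only [planeDot, Prod.fst_sub, Prod.snd_sub, Prod.smul_fst, smul_eq_mul,
        vadd_eq_add, Prod.fst_add] at hpos ⊢
      rw [← sub_eq_iff_eq_add, div_mul_eq_mul_div, eq_div_iff hpos.ne']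
      linear_combination (-(q.2 - p.2)) * h
    · simp only [planeDot, Prod.fst_sub, Prod.snd_sub, Prod.smul_snd, smul_eq_mul,
        vadd_eq_add, Prod.snd_add] at hpos ⊢
      rw [← sub_eq_iff_eq_add, div_mul_eq_mul_div, eq_div_iff hpos.ne']
      linear_combination (q.1 - p.1) * h

open Finset in
/-- Around a point `p` of a set in general position there are twice as many directions as other
points, none orthogonal to another point and such that every other point lies strictly on the
positive side of more than half of them. -/
theorem GenPos.exists_directions {P : Finset (ℝ × ℝ)} (hgen : GenPos P) {p : ℝ × ℝ} (hp : p ∈ P) :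
    ∃ u : {x // x ∈ P.erase p} × Bool → ℝ × ℝ,
      (∀ i, ∀ q ∈ P.erase p, planeDot (u i) (q - p) ≠ 0) ∧
      ∀ q ∈ P.erase p, Fintype.card ({x // x ∈ P.erase p} × Bool) <
        2 * #{i | 0 < planeDot (u i) (q - p)} := by
  classical
  obtain ⟨ε, hε, hεpos⟩ : ∃ ε : ℝ, (∀ d ∈ P.erase p, ∀ q ∈ P.erase p, d ≠ q →
      |ε * planeDot (d - p) (q - p)| < |planeCross (d - p) (q - p)|) ∧ 0 < ε := by
    have hev : ∀ᶠ ε : ℝ in nhdsWithin 0 (Set.Ioi 0), ∀ d ∈ P.erase p, ∀ q ∈ P.erase p, d ≠ q →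
        |ε * planeDot (d - p) (q - p)| < |planeCross (d - p) (q - p)| := by
      rw [Filter.eventually_all_finset]
      intro d hd
      rw [Filter.eventually_all_finset]
      intro q hq
      by_cases hdq : d = q
      · simp [hdq]
      · rw [mem_erase] at hd hq
        have hne := abs_pos.2
          (hgen.planeCross_ne_zero hp hd.2 hq.2 hd.1.symm hq.1.symm hdq)
        have hcont : Filter.Tendsto (fun ε : ℝ => |ε * planeDot (d - p) (q - p)|) (nhds 0)
            (nhds |0 * planeDot (d - p) (q - p)|) := by
          apply Continuous.tendsto (f := fun ε : ℝ => |ε * planeDot (d - p) (q - p)|)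
          fun_prop
        rw [zero_mul, abs_zero] at hcont
        filter_upwards [(hcont.mono_left nhdsWithin_le_nhds).eventually_lt_const hne] with ε h _
        exact h
    exact (hev.and self_mem_nhdsWithin).exists
  let sg : Bool → ℝ := fun b => if b then 1 else -1
  let u : {x // x ∈ P.erase p} × Bool → ℝ × ℝ := fun i =>
    (ε * (i.1.1 - p).1 - sg i.2 * (i.1.1 - p).2, ε * (i.1.1 - p).2 + sg i.2 * (i.1.1 - p).1)
  have hu : ∀ i q, planeDot (u i) (q - p) =
      ε * planeDot (i.1.1 - p) (q - p) + sg i.2 * planeCross (i.1.1 - p) (q - p) := by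
    intro i q
    simp only [u, planeDot, planeCross]; ring
  have hself : ∀ i, 0 < planeDot (u i) (i.1.1 - p) := by
    intro i
    have hcr : planeCross (i.1.1 - p) (i.1.1 - p) = 0 := by simp only [planeCross]; ring
    rw [hu, hcr, mul_zero, add_zero]
    exact mul_pos hεpos (planeDot_self_pos (sub_ne_zero.2 (mem_erase.1 i.1.2).1))
  refine ⟨u, ?_, ?_⟩
  · rintro ⟨d, b⟩ q hq
    by_cases hdq : d.1 = q
    · exact hdq ▸ (hself (d, b)).ne'
    · rw [hu]
      intro h
      have hlt := hε d.1 d.2 q hq hdq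
      cases b <;> simp only [sg, Bool.false_eq_true, if_true, if_false] at h
      · rw [show ε * planeDot (d.1 - p) (q - p) = planeCross (d.1 - p) (q - p) by linarith] at hlt
        exact lt_irrefl _ hlt
      · rw [show ε * planeDot (d.1 - p) (q - p) = -planeCross (d.1 - p) (q - p) by linarith,
          abs_neg] at hlt
        exact lt_irrefl _ hlt
  · intro q hq
    have hcompl : #{i | ¬ 0 < planeDot (u i) (q - p)} ≤
        #((univ : Finset {x // x ∈ P.erase p}).erase ⟨q, hq⟩) := by
      refine card_le_card_of_injOn Prod.fst ?_ ?_
      · intro i hi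
        rw [mem_coe, mem_filter] at hi
        simp only [mem_coe, mem_erase, mem_univ, and_true]
        intro h
        have := hself i
        rw [h] at this
        exact hi.2 this
      · rintro ⟨d, b⟩ hi ⟨d', b'⟩ hj hdd
        obtain rfl : d = d' := hdd
        by_contra hne
        rw [mem_coe, mem_filter] at hi hj
        have hdq : d.1 ≠ q := fun h => hi.2 (h ▸ hself (d, b))
        have hlt := hε d.1 d.2 q hq hdq
        have hi' := hi.2
        have hj' := hj.2
        rw [hu, not_lt] at hi' hj'
        have hsum : ε * planeDot (d.1 - p) (q - p) ≤ -|planeCross (d.1 - p) (q - p)| := by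
          cases b <;> cases b' <;>
            simp only [sg, Bool.false_eq_true, if_true, if_false, not_true] at hi' hj' hne <;>
            rcases abs_cases (planeCross (d.1 - p) (q - p)) with h | h <;> linarith
        linarith [neg_abs_le (ε * planeDot (d.1 - p) (q - p))]
    rw [card_erase_of_mem (mem_univ _), card_univ] at hcompl
    have hpos : 0 < Fintype.card {x // x ∈ P.erase p} := Fintype.card_pos_iff.2 ⟨⟨q, hq⟩⟩
    have htot := card_filter_add_card_filter_not
      (s := (univ : Finset ({x // x ∈ P.erase p} × Bool))) fun i => 0 < planeDot (u i) (q - p)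
    rw [card_univ, Fintype.card_prod, Fintype.card_bool] at htot
    rw [Fintype.card_prod, Fintype.card_bool]
    omega

open Finset in
/-- If every open half-plane bounded by a line through `p` is beaten by `p` in one of finitely many
orders, then there is a set of an odd number of orders such that `p` beats every other point in
more than half of them. -/
theorem GenPos.exists_odd_majority {P : Finset (ℝ × ℝ)} (hgen : GenPos P) {p : ℝ × ℝ}
    (hp : p ∈ P) {κ : Type*} [DecidableEq κ] [Nonempty κ] (beats : κ → ℝ × ℝ → Prop)
    [∀ c q, Decidable (beats c q)]
    (hbeats : ∀ v, ∃ c, ∀ q ∈ P, 0 < planeDot v (q - p) → beats c q) :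
    ∃ S : Finset κ, Odd #S ∧ ∀ q ∈ P.erase p, #S < 2 * #{c ∈ S | beats c q} := by
  classical
  by_cases htop : ∃ c, ∀ q ∈ P.erase p, beats c q
  · obtain ⟨c, hc⟩ := htop
    refine ⟨{c}, by simp, fun q hq => ?_⟩
    rw [filter_true_of_mem (by simpa using hc q hq)]
    simp
  push Not at htop
  choose top htopP htop using htop
  obtain ⟨u, hne, hmaj⟩ := hgen.exists_directions hp
  choose col hcol using fun i => hbeats (u i)
  let w : _ → ℝ × ℝ := fun i => top (col i) - p
  have hw : ∀ i, planeDot (w i) (u i) < 0 := by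
    intro i
    have hcomm : planeDot (w i) (u i) = planeDot (u i) (top (col i) - p) := by
      simp only [w, planeDot]; ring
    rw [hcomm]
    refine lt_of_le_of_ne (not_lt.1 fun h => ?_) (hne i _ (htopP _))
    exact htop (col i) (hcol i _ (mem_of_mem_erase (htopP _)) h)
  let key : _ → ℝ := fun i => planeCross (w i) (u i) / -planeDot (w i) (u i)
  have hkey : ∀ i q, 0 < planeDot (u i) (q - p) ↔
      0 < -planeDot (w i) (q - p) + planeCross (w i) (q - p) * key i := by
    intro i q
    have hpos : 0 < planeDot (w i) (w i) :=
      planeDot_self_pos (sub_ne_zero.2 (mem_erase.1 (htopP (col i))).1)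
    have hneg : 0 < -planeDot (w i) (u i) := neg_pos.2 (hw i)
    have h := planeDot_self_mul (w i) (u i) (q - p)
    have hk : -planeDot (w i) (u i) *
        (-planeDot (w i) (q - p) + planeCross (w i) (q - p) * key i) =
        planeDot (w i) (w i) * planeDot (u i) (q - p) := by
      rw [h]
      have := (hw i).ne
      simp only [key]
      field_simp
      ring
    rw [← mul_pos_iff_of_pos_left hpos, ← hk, mul_pos_iff_of_pos_left hneg]
  obtain ⟨A, hA⟩ := exists_majority_image (P.erase p)
    (fun q => {i | 0 < planeDot (u i) (q - p)}) col key (by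
      intro q hq i j k hij hjk hkij hkjk hi hk
      have hwij : w i = w j := by simp only [w, hij]
      have hwjk : w k = w j := by simp only [w, hjk]
      simp only [mem_filter, mem_univ, true_and, hkey, hwij, hwjk] at hi hk ⊢
      exact affine_pos_of_between hkij hkjk hi hk) (by
      intro b E hE hEne hEb
      simp only [mem_filter, mem_univ, true_and] at hEb
      let s : ℝ × ℝ → ℝ := fun q => planeCross (u b) (q - p) / planeDot (u b) (q - p)
      obtain ⟨q₁, hq₁, hmin⟩ := exists_min_image E s hEne
      obtain ⟨q₂, hq₂, hmax⟩ := exists_max_image E s hEne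
      refine ⟨q₁, hq₁, q₂, hq₂, fun q hq i hi => ?_⟩
      have hub : 0 < planeDot (u b) (u b) := by
        refine planeDot_self_pos fun h => ?_
        have := hEb q hq
        simp [h, planeDot] at this
      have hs : ∀ q ∈ E, 0 < -planeDot (u i) (q - p) ↔
          0 < -planeDot (u b) (u i) + -planeCross (u b) (u i) * s q := by
        intro q hq
        have hk : planeDot (u b) (q - p) *
            (-planeDot (u b) (u i) + -planeCross (u b) (u i) * s q) =
            planeDot (u b) (u b) * -planeDot (u i) (q - p) := by
          rw [mul_neg, planeDot_self_mul (u b) (u i) (q - p)]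
          have := (hEb q hq).ne'
          simp only [s]
          field_simp
          ring
        rw [← mul_pos_iff_of_pos_left hub, ← hk, mul_pos_iff_of_pos_left (hEb q hq)]
      simp only [mem_union, mem_filter, mem_univ, true_and] at hi ⊢
      by_contra! hcon
      have h₁ : 0 < -planeDot (u i) (q₁ - p) :=
        neg_pos.2 (lt_of_le_of_ne hcon.1 (hne i q₁ (hE hq₁)))
      have h₂ : 0 < -planeDot (u i) (q₂ - p) :=
        neg_pos.2 (lt_of_le_of_ne hcon.2 (hne i q₂ (hE hq₂)))
      have := (hs q hq).2 (affine_pos_of_between (hmin q hq) (hmax q hq) ((hs q₁ hq₁).1 h₁)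
        ((hs q₂ hq₂).1 h₂))
      linarith) hmaj
  have hS : ∀ q ∈ P.erase p, #(A.image col) < 2 * #{c ∈ A.image col | beats c q} := by
    intro q hq
    refine (hA q hq).trans_le (Nat.mul_le_mul_left 2 (card_le_card ?_))
    intro c hc
    obtain ⟨i, hi, rfl⟩ := mem_image.1 hc
    simp only [mem_inter, mem_filter, mem_univ, true_and] at hi
    exact mem_filter.2 ⟨mem_image_of_mem col hi.1, hcol i q (mem_of_mem_erase hq) hi.2⟩
  have hq₀ := htopP (Classical.arbitrary κ)
  rcases Nat.even_or_odd #(A.image col) with heven | hodd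
  · have hcard₀ := hS _ hq₀
    have hle := card_le_card (filter_subset (fun c => beats c (top (Classical.arbitrary κ)))
      (A.image col))
    obtain ⟨c, hc⟩ : (A.image col).Nonempty := card_pos.1 (by omega)
    have hcard := card_erase_of_mem hc
    have hpos : 0 < #(A.image col) := card_pos.2 ⟨c, hc⟩
    obtain ⟨n, hn⟩ := heven
    refine ⟨(A.image col).erase c, ⟨n - 1, by omega⟩, fun q hq => ?_⟩
    have h := hS q hq
    have hfil : #{c ∈ A.image col | beats c q} ≤ #{x ∈ (A.image col).erase c | beats x q} + 1 := by
      rw [filter_erase]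
      exact Nat.sub_le_iff_le_add.1 pred_card_le_card_erase
    omega
  · exact ⟨A.image col, hodd, hS⟩

/-- The points of `P` in an open half-plane form a closed set. -/
theorem rclosed_filter_planeDot_pos (P : Finset (ℝ × ℝ)) (v p : ℝ × ℝ) :
    RClosed P {q ∈ P | 0 < planeDot v (q - p)} := by
  refine ⟨Finset.filter_subset _ _, fun x hx hconv => Finset.mem_filter.2 ⟨hx, ?_⟩⟩
  have hc : Convex ℝ {q : ℝ × ℝ | 0 < planeDot v (q - p)} := by
    intro x hx y hy a b ha hb hab
    simp only [Set.mem_ofPred_eq, planeDot, Prod.fst_sub, Prod.snd_sub, Prod.fst_add,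
      Prod.snd_add, Prod.smul_fst, Prod.smul_snd, smul_eq_mul] at hx hy ⊢
    obtain rfl : b = 1 - a := by linarith
    rcases ha.eq_or_lt with rfl | ha
    · linarith
    · nlinarith [mul_pos ha hx, mul_nonneg hb hy.le]
  exact convexHull_min (fun q hq => (Finset.mem_filter.1 hq).2) hc hconv

theorem rclosed_singleton {P : Finset (ℝ × ℝ)} {p : ℝ × ℝ} (hp : p ∈ P) : RClosed P {p} :=
  ⟨by simpa using hp, fun x _ hx => by simpa using hx⟩

open Finset in
/-- At most `2 ^ (k - 1)` elements can be labelled injectively by subsets of `Fin k` of odd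
cardinality. -/
theorem card_le_two_pow_of_odd_injOn {α : Type*} (P : Finset α) {k : ℕ} (hk : 0 < k)
    (S : α → Finset (Fin k)) (hodd : ∀ p ∈ P, Odd #(S p)) (hinj : Set.InjOn S P) :
    #P ≤ 2 ^ (k - 1) := by
  let c : Fin k := ⟨0, hk⟩
  have hcard : #((univ.erase c).powerset) = 2 ^ (k - 1) := by
    rw [card_powerset, card_erase_of_mem (mem_univ _), card_univ, Fintype.card_fin]
  rw [← hcard]
  refine card_le_card_of_injOn (fun p => (S p).erase c) ?_ ?_
  · intro p _
    exact mem_powerset.2 (erase_subset_erase _ (subset_univ _))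
  · intro p hp q hq hpq
    refine hinj hp hq ?_
    simp only at hpq
    have hop := hodd p hp
    have hoq := hodd q hq
    have hcc := congrArg card hpq
    by_cases h₁ : c ∈ S p <;> by_cases h₂ : c ∈ S q
    · rw [← insert_erase h₁, hpq, insert_erase h₂]
    · rw [erase_eq_of_notMem h₂, card_erase_of_mem h₁] at hcc
      have := card_pos.2 ⟨c, h₁⟩
      obtain ⟨a, ha⟩ := hop
      obtain ⟨b, hb⟩ := hoq
      omega
    · rw [erase_eq_of_notMem h₁, card_erase_of_mem h₂] at hcc
      have := card_pos.2 ⟨c, h₂⟩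
      obtain ⟨a, ha⟩ := hop
      obtain ⟨b, hb⟩ := hoq
      omega
    · rwa [erase_eq_of_notMem h₁, erase_eq_of_notMem h₂] at hpq

/-- If `P` is a finite planar point set in general position and the order
dimension of the lattice of closed sets of the realizable convex geometry on `P` equals `k`
(i.e. `k` is the least positive size of a realizer), then `|P| ≤ 2 ^ (k - 1)`. -/
theorem card_le_of_orderDim (P : Finset (ℝ × ℝ)) (hgen : GenPos P) (k : ℕ)
    (hdim : IsLeast {t : ℕ | 0 < t ∧ RHasRealizer P t} k) :
    P.card ≤ 2 ^ (k - 1) := by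
  classical
  obtain ⟨hk, r, hlin, hext, hreal⟩ := hdim.1
  have : Nonempty (Fin k) := ⟨⟨0, hk⟩⟩
  let beats : ℝ × ℝ → Fin k → ℝ × ℝ → Prop := fun p c q =>
    ∃ (hp : p ∈ P) (hq : q ∈ P), ¬ r c ⟨{p}, rclosed_singleton hp⟩ ⟨{q}, rclosed_singleton hq⟩
  have hS : ∀ p ∈ P, ∃ S : Finset (Fin k), Odd S.card ∧
      ∀ q ∈ P.erase p, S.card < 2 * (S.filter fun c => beats p c q).card := by
    intro p hp
    refine hgen.exists_odd_majority hp (beats p) fun v => ?_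
    by_contra! hcon
    have hsub := hreal ⟨{p}, rclosed_singleton hp⟩ ⟨_, rclosed_filter_planeDot_pos P v p⟩ (by
      intro c
      obtain ⟨q, hq, hqv, hb⟩ := hcon c
      have := hlin c
      refine _root_.trans (r := r c) (b := ⟨{q}, rclosed_singleton hq⟩) ?_ (hext c _ _ ?_)
      · by_contra h
        exact hb ⟨hp, hq, h⟩
      · simpa using ⟨hq, hqv⟩)
    have hpp := (Finset.mem_filter.1 (hsub (Finset.mem_singleton_self p))).2
    simp [planeDot] at hpp
  choose! S hodd hmaj using hS
  refine card_le_two_pow_of_odd_injOn P hk S hodd fun p hp q hq hpq => ?_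
  by_contra hne
  have h₁ := hmaj p hp q (Finset.mem_erase.2 ⟨Ne.symm hne, hq⟩)
  have h₂ := hmaj q hq p (Finset.mem_erase.2 ⟨hne, hp⟩)
  rw [← hpq] at h₂
  have hdisj : Disjoint ((S p).filter fun c => beats p c q)
      ((S p).filter fun c => beats q c p) := by
    refine Finset.disjoint_filter.2 fun c _ hpc hqc => ?_
    obtain ⟨_, _, hpc⟩ := hpc
    obtain ⟨_, _, hqc⟩ := hqc
    have := hlin c
    exact (total_of (r c) _ _).elim hpc hqc
  have h₃ := Finset.card_le_card (Finset.union_subset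
    (Finset.filter_subset (fun c => beats p c q) (S p))
    (Finset.filter_subset (fun c => beats q c p) (S p)))
  rw [Finset.card_union_of_disjoint hdisj] at h₃
  omega
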